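/- arXiv:1405.3529 — 2 statements merged into one kernel-verified Lean document; each statement's English description precedes it below -/
import Mathlib

section
/- Let T be a linear involution without connection. A nonempty word w in the natural coding L(T) is even if and only if the intervals I_w and I_{w⁻¹} belong to distinct components of Î; equivalently, w is even if and only if for every z ∈ I_w (with z ∉ Ô), the points z and T^{|w|}(z) belong to the same component of Î. -/
open Set

namespace LinInv

/-- A letter of the extended alphabet `A ∪ A⁻¹`, encoded as a pair of a letter
of `A` and a sign. -/
abbrev Letter (A : Type*) := A × Bool

/-- The formal inverse of a letter. -/
def Letter.inv {A : Type*} (c : Letter A) : Letter A := (c.1, !c.2)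

/-- The inverse of a word over `A ∪ A⁻¹`. -/
def wordInv {A : Type*} (u : List (Letter A)) : List (Letter A) :=
  (u.map Letter.inv).reverse

/-- The involution `σ₂` exchanging the two components of `Î = I × {0,1}`. -/
def s2 (z : ℝ × Bool) : ℝ × Bool := (z.1, !z.2)

/-- A linear involution on the alphabet `A`: the open interval `I = ]lo,hi[`,
for each `c ∈ A ∪ A⁻¹` an open subinterval `I_c = ]endLo c, endHi c[ × {comp c}`
of one of the two components of `Î = I × {0,1}`, the finite set `Sig` of division
points, and the first involution `σ₁`, subject to the defining conditions. -/
structure LinearInvolution (A : Type*) [Fintype A] where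
  lo : ℝ
  hi : ℝ
  lo_lt_hi : lo < hi
  endLo : Letter A → ℝ
  endHi : Letter A → ℝ
  end_lt : ∀ c, endLo c < endHi c
  comp : Letter A → Bool
  sub_lo : ∀ c, lo ≤ endLo c
  sub_hi : ∀ c, endHi c ≤ hi
  /-- the length data satisfy `λ_a = λ_{a⁻¹}` -/
  len_inv : ∀ c, endHi c - endLo c = endHi (Letter.inv c) - endLo (Letter.inv c)
  /-- the set of division points -/
  Sig : Set (ℝ × Bool)
  Sig_sub : Sig ⊆ Ioo lo hi ×ˢ (univ : Set Bool)
  /-- there are `2k-2` division points -/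
  Sig_card : Sig.ncard = 2 * Fintype.card A - 2
  /-- the intervals `I_c` are pairwise disjoint -/
  disj : ∀ c d : Letter A, c ≠ d →
    Disjoint (Ioo (endLo c) (endHi c) ×ˢ ({comp c} : Set Bool))
      (Ioo (endLo d) (endHi d) ×ˢ ({comp d} : Set Bool))
  Sig_disj : ∀ c : Letter A,
    Disjoint Sig (Ioo (endLo c) (endHi c) ×ˢ ({comp c} : Set Bool))
  /-- the intervals `I_c` partition `Î` minus the division points -/
  cover : Ioo lo hi ×ˢ (univ : Set Bool) =
    (⋃ c : Letter A, Ioo (endLo c) (endHi c) ×ˢ ({comp c} : Set Bool)) ∪ Sig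
  /-- the first involution `σ₁` (as a total map; only its values on `Î ∖ Σ` matter) -/
  s1 : ℝ × Bool → ℝ × Bool
  s1_invol : ∀ z ∈ (Ioo lo hi ×ˢ (univ : Set Bool)) \ Sig, s1 (s1 z) = z
  /-- on each `I_c`, `σ₁` is either a translation or a symmetry -/
  s1_iso : ∀ c : Letter A,
    (∃ α : ℝ, ∀ z ∈ Ioo (endLo c) (endHi c) ×ˢ ({comp c} : Set Bool),
        s1 z = (z.1 + α, comp (Letter.inv c))) ∨
    (∃ α : ℝ, ∀ z ∈ Ioo (endLo c) (endHi c) ×ˢ ({comp c} : Set Bool),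
        s1 z = (-z.1 + α, comp (Letter.inv c)))
  /-- `σ₁` maps `I_c` onto `I_{c⁻¹}` -/
  s1_image : ∀ c : Letter A,
    s1 '' (Ioo (endLo c) (endHi c) ×ˢ ({comp c} : Set Bool)) =
      Ioo (endLo (Letter.inv c)) (endHi (Letter.inv c)) ×ˢ
        ({comp (Letter.inv c)} : Set Bool)

namespace LinearInvolution

variable {A : Type*} [Fintype A] (L : LinearInvolution A)

/-- The domain `Î = I × {0,1}`. -/
def Ihat : Set (ℝ × Bool) := Ioo L.lo L.hi ×ˢ (univ : Set Bool)

/-- The interval `I_c` associated with the letter `c ∈ A ∪ A⁻¹`. -/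
def Ia (c : Letter A) : Set (ℝ × Bool) :=
  Ioo (L.endLo c) (L.endHi c) ×ˢ ({L.comp c} : Set Bool)

/-- The linear involution `T = σ₂ ∘ σ₁`. -/
def T (z : ℝ × Bool) : ℝ × Bool := s2 (L.s1 z)

/-- `O = ⋃_{n ≥ 0} T⁻ⁿ(Σ)`, the negative orbit of the singular points. -/
def O : Set (ℝ × Bool) := ⋃ n : ℕ, (L.T)^[n] ⁻¹' L.Sig

/-- `Ô = O ∪ σ₂(O)`. -/
def Ohat : Set (ℝ × Bool) := L.O ∪ s2 '' L.O

/-- `T` has a connection if some singularity `x` of `T⁻¹` reaches a singularity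
`y` of `T` in `n ≥ 0` steps. -/
def HasConnection : Prop := ∃ x ∈ s2 '' L.Sig, ∃ n : ℕ, (L.T)^[n] x ∈ L.Sig

/-- `T` is nonorientable if some `I_c` and `I_{c⁻¹}` lie in the same component. -/
def Nonorientable : Prop := ∃ c : Letter A, L.comp c = L.comp (Letter.inv c)

/-- `T` is orientable if it is not nonorientable. -/
def Orientable : Prop := ¬ L.Nonorientable

/-- `u` occurs in the natural coding of the orbit of `z` at position `m`. -/
def IsCodingFrom (z : ℝ × Bool) (m : ℕ) (u : List (Letter A)) : Prop :=
  ∀ i : Fin u.length, (L.T)^[m + i.1] z ∈ L.Ia (u.get i)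

/-- The natural coding `L(T)`: the set of factors of the infinite natural
codings `Σ_T(z)` for `z ∈ Î ∖ Ô`. -/
def lang : Set (List (Letter A)) :=
  {u | ∃ z ∈ L.Ihat \ L.Ohat, ∃ m : ℕ, L.IsCodingFrom z m u}

/-- The interval `I_w = I_{a₀} ∩ T⁻¹(I_{a₁}) ∩ ⋯ ∩ T^{-m+1}(I_{a_{m-1}})`
associated with a word `w = a₀a₁⋯a_{m-1}`; by convention `I_ε = Î`. -/
def Iw (u : List (Letter A)) : Set (ℝ × Bool) :=
  L.Ihat ∩ ⋂ i : Fin u.length, (L.T)^[i.1] ⁻¹' L.Ia (u.get i)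

/-- The return time `ρ_X(x) = inf {n ≥ 1 ∣ Tⁿ(x) ∈ X}`, with value `∞` if the
orbit of `x` never returns to `X`. -/
noncomputable def retTime (X : Set (ℝ × Bool)) (x : ℝ × Bool) : ℕ∞ :=
  sInf {n : ℕ∞ | ∃ m : ℕ, n = (m : ℕ∞) ∧ 1 ≤ m ∧ (L.T)^[m] x ∈ X}

/-- A word is even if it has an even number of odd letters (a letter `a` is odd
when `I_a` and `I_{a⁻¹}` lie in the same component). -/
def EvenWord (u : List (Letter A)) : Prop :=
  Even (u.countP fun c => L.comp (c.1, true) == L.comp (c.1, false))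

/-- The morphism `F_A → ℤ/2ℤ` sending each odd letter to `1` and each even
letter to `0`. -/
noncomputable def evenHom : FreeGroup A →* Multiplicative (ZMod 2) :=
  FreeGroup.lift fun a =>
    Multiplicative.ofAdd (if L.comp (a, true) = L.comp (a, false) then (1 : ZMod 2) else 0)

/-- The even group: the subgroup of `F_A` formed by the even elements. -/
noncomputable def evenGroup : Subgroup (FreeGroup A) := (L.evenHom).ker

/-- The admissibility condition at an endpoint `x` of an interval `J`:
either `x = Tⁿ(z)` for a singularity `z` of `T⁻¹` with `T^k(z) ∉ J` for
`0 ≤ k ≤ n`, or `Tⁿ(x) = z` for a singularity `z` of `T` with `T^k(x) ∉ J`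
for `0 ≤ k ≤ n`. -/
def AdmissibleEndpoint (J : Set (ℝ × Bool)) (x : ℝ × Bool) : Prop :=
  (∃ z ∈ s2 '' L.Sig, ∃ n : ℕ, (L.T)^[n] z = x ∧ ∀ k ≤ n, (L.T)^[k] z ∉ J) ∨
  (∃ z ∈ L.Sig, ∃ n : ℕ, (L.T)^[n] x = z ∧ ∀ k ≤ n, (L.T)^[k] x ∉ J)

/-- The open interval `]u,v[ × {δ}` is admissible with respect to `T`. -/
def AdmissibleInterval (u v : ℝ) (δ : Bool) : Prop :=
  u < v ∧ L.AdmissibleEndpoint (Ioo u v ×ˢ ({δ} : Set Bool)) (u, δ) ∧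
    L.AdmissibleEndpoint (Ioo u v ×ˢ ({δ} : Set Bool)) (v, δ)

end LinearInvolution

/-- A set of words is factorial if it contains the factors of its elements. -/
def FactorialSet {α : Type*} (S : Set (List α)) : Prop :=
  ∀ u ∈ S, ∀ v : List α, v <:+: u → v ∈ S

/-- A word over `A ∪ A⁻¹` is reduced if it has no factor `c c⁻¹`. -/
def Reduced {A : Type*} (u : List (Letter A)) : Prop :=
  u.Chain' fun c d => d ≠ Letter.inv c

/-- A laminary set on `A`: a symmetric factorial set of reduced words on
`A ∪ A⁻¹`. -/
def Laminary {A : Type*} (S : Set (List (Letter A))) : Prop :=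
  FactorialSet S ∧ (∀ u ∈ S, wordInv u ∈ S) ∧ ∀ u ∈ S, Reduced u

/-- A laminary set is orientable if it splits as `S₊ ∪ S₋` with `S₊, S₋`
factorial, `S₊ ∩ S₋ = {ε}`, and `x ∈ S₋ ↔ x⁻¹ ∈ S₊`. -/
def OrientableSet {A : Type*} (S : Set (List (Letter A))) : Prop :=
  ∃ Sp Sm : Set (List (Letter A)), FactorialSet Sp ∧ FactorialSet Sm ∧
    S = Sp ∪ Sm ∧ Sp ∩ Sm = {([] : List (Letter A))} ∧
    ∀ x ∈ S, (x ∈ Sm ↔ wordInv x ∈ Sp)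

/-- A set of words is uniformly recurrent if it is right extendable and every
`u ∈ S` occurs in every long enough word of `S`. -/
def UniformlyRecurrent {α : Type*} (S : Set (List α)) : Prop :=
  (∀ u ∈ S, ∃ c : α, u ++ [c] ∈ S) ∧
  ∀ u ∈ S, ∃ n : ℕ, 1 ≤ n ∧ ∀ w ∈ S, w.length = n → u <:+: w

/-- A set of words over `A ∪ A⁻¹` is uniformly semi-recurrent if it is right
extendable and for every `u ∈ S`, every long enough word of `S` contains `u` or
`u⁻¹` as a factor. -/
def UniformlySemiRecurrent {A : Type*} (S : Set (List (Letter A))) : Prop :=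
  (∀ u ∈ S, ∃ c : Letter A, u ++ [c] ∈ S) ∧
  ∀ u ∈ S, ∃ n : ℕ, 1 ≤ n ∧ ∀ w ∈ S, w.length = n → (u <:+: w ∨ wordInv u <:+: w)

/-- A laminary set is semi-recurrent if for all `u, w ∈ S` there is `v ∈ S`
with `uvw ∈ S` or `uvw⁻¹ ∈ S`. -/
def SemiRecurrent {A : Type*} (S : Set (List (Letter A))) : Prop :=
  ∀ u ∈ S, ∀ w ∈ S, ∃ v ∈ S, u ++ v ++ w ∈ S ∨ u ++ v ++ wordInv w ∈ S

/-- A complete return word to `X ⊆ S`: a word of `S` with a proper prefix in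
`X` and a proper suffix in `X`. -/
def CompleteReturnWord {α : Type*} (S X : Set (List α)) (u : List α) : Prop :=
  u ∈ S ∧ (∃ p ∈ X, p <+: u ∧ p ≠ u) ∧ (∃ s ∈ X, s <:+ u ∧ s ≠ u)

/-- A complete first return word to `X`: a complete return word to `X` with no
internal factor in `X`. -/
def CompleteFirstReturnWord {α : Type*} (S X : Set (List α)) (u : List α) : Prop :=
  CompleteReturnWord S X u ∧
    ¬ ∃ p v s : List α, u = p ++ v ++ s ∧ v ∈ X ∧ p ≠ [] ∧ s ≠ []

/-- `CR S w`: the set of complete first return words to `{w, w⁻¹}` in `S`. -/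
def CR {A : Type*} (S : Set (List (Letter A))) (w : List (Letter A)) :
    Set (List (Letter A)) :=
  {u | CompleteFirstReturnWord S {w, wordInv w} u}

open Classical in
/-- The operation `N` on complete return words to `{w, w⁻¹}`: erase the prefix
`w` if present, and erase the suffix `w⁻¹` if present. -/
noncomputable def NN {A : Type*} (w u : List (Letter A)) : List (Letter A) :=
  let u' := if w <+: u then u.drop w.length else u
  if wordInv w <:+ u' then u'.take (u'.length - w.length) else u'

/-- `MR S w`: the set of mixed first return words to `w` in `S`. -/
noncomputable def MR {A : Type*} (S : Set (List (Letter A))) (w : List (Letter A)) :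
    Set (List (Letter A)) :=
  NN w '' CR S w

/-- `RightReturn S w`: the set of first right return words to `w` in `S`,
i.e. the words `u` such that `wu` is a complete first return word to `{w}`. -/
def RightReturn {α : Type*} (S : Set (List α)) (w : List α) : Set (List α) :=
  {u | CompleteFirstReturnWord S {w} (w ++ u)}

/-- `X` is a basis (free generating set) of the subgroup `H`: the canonical map
`FreeGroup X → G` is injective with range `H`. -/
def IsBasisOf {G : Type*} [Group G] (X : Set G) (H : Subgroup G) : Prop :=
  Function.Injective (FreeGroup.lift (fun x : X => (x : G))) ∧
    (FreeGroup.lift (fun x : X => (x : G)) : FreeGroup X →* G).range = H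

/-- `Y` is a symmetric basis of `H` if `Y = X ∪ X⁻¹` for some basis `X` of `H`. -/
def IsSymmetricBasisOf {G : Type*} [Group G] (Y : Set G) (H : Subgroup G) : Prop :=
  ∃ X : Set G, IsBasisOf X H ∧ Y = X ∪ X⁻¹

/-- The prime words in `S` with respect to a subgroup `G` of `F_A`: the
nonempty words of `G ∩ S` without a proper nonempty prefix in `G ∩ S`. -/
def PrimeWords {A : Type*} (S : Set (List (Letter A))) (G : Subgroup (FreeGroup A)) :
    Set (List (Letter A)) :=
  {u | u ∈ S ∧ u ≠ [] ∧ FreeGroup.mk u ∈ G ∧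
    ∀ p : List (Letter A), p <+: u → p ≠ [] → p ≠ u → ¬(p ∈ S ∧ FreeGroup.mk p ∈ G)}

namespace LinearInvolution

variable {A : Type*} [Fintype A] (L : LinearInvolution A)

theorem Ia_subset_Ihat (c : Letter A) : L.Ia c ⊆ L.Ihat := by
  rintro z ⟨⟨h1, h2⟩, -⟩
  exact ⟨⟨(L.sub_lo c).trans_lt h1, h2.trans_le (L.sub_hi c)⟩, mem_univ _⟩

theorem notMem_Sig_of_mem_Ia {c : Letter A} {z : ℝ × Bool} (hz : z ∈ L.Ia c) : z ∉ L.Sig :=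
  fun h => disjoint_left.1 (L.Sig_disj c) h hz

theorem exists_mem_Ia {z : ℝ × Bool} (hz : z ∈ L.Ihat) (hS : z ∉ L.Sig) : ∃ c, z ∈ L.Ia c := by
  have h := hz
  rw [Ihat, L.cover] at h
  exact mem_iUnion.1 (h.resolve_right hS)

theorem s1_mem_Ia {c : Letter A} {z : ℝ × Bool} (hz : z ∈ L.Ia c) :
    L.s1 z ∈ L.Ia (Letter.inv c) := by
  rw [Ia, ← L.s1_image c]
  exact mem_image_of_mem _ hz

theorem s1_s1_of_mem_Ia {c : Letter A} {z : ℝ × Bool} (hz : z ∈ L.Ia c) :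
    L.s1 (L.s1 z) = z :=
  L.s1_invol z ⟨L.Ia_subset_Ihat c hz, L.notMem_Sig_of_mem_Ia hz⟩

@[simp]
theorem s2_s2 (z : ℝ × Bool) : s2 (s2 z) = z := by
  simp [s2]

theorem s2_mem_Ihat {z : ℝ × Bool} (hz : z ∈ L.Ihat) : s2 z ∈ L.Ihat :=
  ⟨hz.1, mem_univ _⟩

theorem T_mem_Ihat {c : Letter A} {z : ℝ × Bool} (hz : z ∈ L.Ia c) : L.T z ∈ L.Ihat :=
  L.s2_mem_Ihat (L.Ia_subset_Ihat _ (L.s1_mem_Ia hz))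

theorem T_snd_of_mem_Ia {c : Letter A} {z : ℝ × Bool} (hz : z ∈ L.Ia c) :
    (L.T z).2 = !L.comp (Letter.inv c) :=
  congrArg not (L.s1_mem_Ia hz).2

theorem s2_T_mem_Ia {c : Letter A} {z : ℝ × Bool} (hz : z ∈ L.Ia c) :
    s2 (L.T z) ∈ L.Ia (Letter.inv c) := by
  rw [T, s2_s2]
  exact L.s1_mem_Ia hz

/-- The conjugate of `T` by `σ₂` is the inverse of `T`. -/
theorem T_s2_T {c : Letter A} {z : ℝ × Bool} (hz : z ∈ L.Ia c) :
    L.T (s2 (L.T z)) = s2 z := by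
  simp only [T, s2_s2, L.s1_s1_of_mem_Ia hz]

theorem T_iterate_s2_T_iterate {z : ℝ × Bool} {n : ℕ}
    (h : ∀ i < n, ∃ c, (L.T)^[i] z ∈ L.Ia c) {j : ℕ} (hj : j ≤ n) :
    (L.T)^[j] (s2 ((L.T)^[n] z)) = s2 ((L.T)^[n - j] z) := by
  induction j with
  | zero => rfl
  | succ j ih =>
    obtain ⟨c, hc⟩ := h (n - (j + 1)) (by omega)
    rw [Function.iterate_succ_apply', ih (by omega), show n - j = n - (j + 1) + 1 by omega,
      Function.iterate_succ_apply', L.T_s2_T hc]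

theorem evenWord_cons (c : Letter A) (u : List (Letter A)) :
    L.EvenWord (c :: u) ↔ (L.EvenWord u ↔ L.comp c ≠ L.comp (Letter.inv c)) := by
  have hc : L.comp (c.1, true) = L.comp (c.1, false) ↔ L.comp c = L.comp (Letter.inv c) := by
    obtain ⟨a, _ | _⟩ := c <;> simp [Letter.inv, eq_comm]
  by_cases h : L.comp c = L.comp (Letter.inv c)
  · simp [EvenWord, hc.2 h, h, Nat.even_add_one]
  · simp [EvenWord, mt hc.1 h, h]

/-- Parity of a word records whether following it changes the component. -/
theorem evenWord_iff_iterate_snd {u : List (Letter A)} {z : ℝ × Bool}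
    (h : ∀ i (hi : i < u.length), (L.T)^[i] z ∈ L.Ia u[i]) :
    L.EvenWord u ↔ ((L.T)^[u.length] z).2 = z.2 := by
  induction u generalizing z with
  | nil => simp [EvenWord]
  | cons c u ih =>
    have h0 : z ∈ L.Ia c := h 0 (by simp)
    have hu := ih (z := L.T z) fun i hi => h (i + 1) (by simpa using hi)
    have hz : z.2 = L.comp c := h0.2
    rw [evenWord_cons, hu, L.T_snd_of_mem_Ia h0, List.length_cons, Function.iterate_succ_apply, hz]
    cases ((L.T)^[u.length] (L.T z)).2 <;> cases L.comp c <;> cases L.comp (Letter.inv c) <;> simp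

theorem mem_Iw_iff {u : List (Letter A)} {z : ℝ × Bool} :
    z ∈ L.Iw u ↔ z ∈ L.Ihat ∧ ∀ i (hi : i < u.length), (L.T)^[i] z ∈ L.Ia u[i] := by
  simp [Iw, Fin.forall_iff]

theorem s2_iterate_mem_Iw_wordInv {u : List (Letter A)} (hu : u ≠ []) {z : ℝ × Bool}
    (hz : z ∈ L.Iw u) : s2 ((L.T)^[u.length] z) ∈ L.Iw (wordInv u) := by
  rw [mem_Iw_iff] at hz ⊢
  have hmem : ∀ i (hi : i < (wordInv u).length),
      (L.T)^[i] (s2 ((L.T)^[u.length] z)) ∈ L.Ia (wordInv u)[i] := by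
    intro i hi
    have hi' : i < u.length := by simpa [wordInv] using hi
    rw [L.T_iterate_s2_T_iterate (fun k hk => ⟨_, hz.2 k hk⟩) hi'.le,
      show u.length - i = u.length - 1 - i + 1 by omega, Function.iterate_succ_apply']
    simpa [wordInv] using L.s2_T_mem_Ia (hz.2 (u.length - 1 - i) (by omega))
  have hpos : 0 < (wordInv u).length := by
    simpa [wordInv] using List.length_pos_iff.2 hu
  exact ⟨L.Ia_subset_Ihat _ (hmem 0 hpos), hmem⟩

theorem snd_eq_of_mem_Iw {u : List (Letter A)} (hu : u ≠ []) {z z' : ℝ × Bool}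
    (hz : z ∈ L.Iw u) (hz' : z' ∈ L.Iw u) : z.2 = z'.2 := by
  have hpos := List.length_pos_iff.2 hu
  have h : z.2 = _ := ((L.mem_Iw_iff.1 hz).2 0 hpos).2
  have h' : z'.2 = _ := ((L.mem_Iw_iff.1 hz').2 0 hpos).2
  exact h.trans h'.symm

theorem iterate_mem_Ihat_and_exists_mem_Ia {z : ℝ × Bool} (hz : z ∈ L.Ihat) (hO : z ∉ L.O)
    (n : ℕ) : (L.T)^[n] z ∈ L.Ihat ∧ ∃ c, (L.T)^[n] z ∈ L.Ia c := by
  have hS : ∀ n, (L.T)^[n] z ∉ L.Sig := fun n h => hO (mem_iUnion.2 ⟨n, h⟩)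
  induction n with
  | zero => exact ⟨hz, L.exists_mem_Ia hz (hS 0)⟩
  | succ n ih =>
    obtain ⟨c, hc⟩ := ih.2
    have h : (L.T)^[n + 1] z ∈ L.Ihat := by
      rw [Function.iterate_succ_apply']
      exact L.T_mem_Ihat hc
    exact ⟨h, L.exists_mem_Ia h (hS _)⟩

/-- The set `Î ∖ Ô` is stable under `T`. -/
theorem iterate_mem_Ihat_diff_Ohat {z : ℝ × Bool} (hz : z ∈ L.Ihat \ L.Ohat) (m : ℕ) :
    (L.T)^[m] z ∈ L.Ihat \ L.Ohat := by
  obtain ⟨hzI, hzO⟩ := hz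
  have hO : z ∉ L.O := fun h => hzO (Or.inl h)
  have hc := L.iterate_mem_Ihat_and_exists_mem_Ia hzI hO
  refine ⟨(hc m).1, ?_⟩
  rintro (h | ⟨y, hy, hyz⟩)
  · obtain ⟨n, hn⟩ := mem_iUnion.1 h
    refine hO (mem_iUnion.2 ⟨n + m, ?_⟩)
    rwa [mem_preimage, Function.iterate_add_apply]
  · obtain ⟨n, hn⟩ := mem_iUnion.1 hy
    have hy' : y = s2 ((L.T)^[m] z) := by rw [← hyz, s2_s2]
    rw [mem_preimage, hy'] at hn
    have key := fun j (hj : j ≤ m) =>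
      L.T_iterate_s2_T_iterate (fun i _ => (hc i).2) (n := m) (j := j) hj
    rcases le_or_gt m n with hmn | hmn
    · refine hzO (Or.inr ⟨s2 z, mem_iUnion.2 ⟨n - m, ?_⟩, s2_s2 z⟩)
      have hm := key m le_rfl
      rw [Nat.sub_self] at hm
      rw [mem_preimage]
      rwa [show n = n - m + m by omega, Function.iterate_add_apply, hm] at hn
    · obtain ⟨c, hcm⟩ := (hc (m - n - 1)).2
      rw [key n hmn.le, show m - n = m - n - 1 + 1 by omega, Function.iterate_succ_apply'] at hn
      exact L.notMem_Sig_of_mem_Ia (L.s2_T_mem_Ia hcm) hn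

theorem exists_mem_Iw_diff_Ohat {u : List (Letter A)} (hu : u ∈ L.lang) :
    (L.Iw u \ L.Ohat).Nonempty := by
  obtain ⟨z, hz, m, hm⟩ := hu
  obtain ⟨h1, h2⟩ := L.iterate_mem_Ihat_diff_Ohat hz m
  refine ⟨(L.T)^[m] z, L.mem_Iw_iff.2 ⟨h1, fun i hi => ?_⟩, h2⟩
  rw [← Function.iterate_add_apply, add_comm]
  exact hm ⟨i, hi⟩

end LinearInvolution

/-- a nonempty `w ∈ L(T)` is even iff `I_w` and `I_{w⁻¹}` lie in
distinct components of `Î`, iff every `z ∈ I_w ∖ Ô` and `T^{|w|}(z)` lie in the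
same component. -/
theorem stmt_16 {A : Type*} [Fintype A] (L : LinearInvolution A)
    (hnc : ¬ L.HasConnection) (w : List (Letter A)) (hw : w ∈ L.lang)
    (hne : w ≠ []) :
    (L.EvenWord w ↔ ∀ z ∈ L.Iw w, ∀ z' ∈ L.Iw (wordInv w), z.2 ≠ z'.2) ∧
    (L.EvenWord w ↔ ∀ z ∈ L.Iw w \ L.Ohat, ((L.T)^[w.length] z).2 = z.2) := by
  have hpar := fun z (hz : z ∈ L.Iw w) => L.evenWord_iff_iterate_snd (L.mem_Iw_iff.1 hz).2
  obtain ⟨z₀, hz₀, hz₀O⟩ := L.exists_mem_Iw_diff_Ohat hw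
  have hinv : wordInv w ≠ [] := by simpa [wordInv] using hne
  constructor
  · constructor
    · intro he z hz z' hz' heq
      have h := (hpar z hz).1 he
      have h' : z'.2 = !((L.T)^[w.length] z).2 :=
        L.snd_eq_of_mem_Iw hinv hz' (L.s2_iterate_mem_Iw_wordInv hne hz)
      rw [h, ← heq] at h'
      exact (Bool.not_ne_self _) h'.symm
    · intro h
      have h₀ : z₀.2 ≠ !((L.T)^[w.length] z₀).2 :=
        h z₀ hz₀ _ (L.s2_iterate_mem_Iw_wordInv hne hz₀)
      rw [hpar z₀ hz₀]
      simpa using h₀.symm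
  · exact ⟨fun he z hz => (hpar z hz.1).1 he, fun h => (hpar z₀ hz₀).2 (h z₀ ⟨hz₀, hz₀O⟩)⟩

end LinInv
end

section
/- Let S be a semi-recurrent orientable laminary set on the alphabet A. Then the pair of components (S₊, S₋) of S is unique up to interchanging S₊ and S₋; that is, if S = S₊ ∪ S₋ = S₊' ∪ S₋' are two decompositions into factorial sets with S₊ ∩ S₋ = S₊' ∩ S₋' = {ε} and with x ∈ S₋ iff x⁻¹ ∈ S₊ (and likewise for the primed pair), then {S₊, S₋} = {S₊', S₋'}. -/
open Set

namespace LinInv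

/-- `(P, M)` is a pair of components of `S`. -/
structure IsComponents {A : Type*} (S P M : Set (List (Letter A))) : Prop where
  factorial_left : FactorialSet P
  factorial_right : FactorialSet M
  eq_union : S = P ∪ M
  inter : P ∩ M = {([] : List (Letter A))}
  mem_right_iff : ∀ x ∈ S, (x ∈ M ↔ wordInv x ∈ P)

theorem wordInv_wordInv {A : Type*} (u : List (Letter A)) : wordInv (wordInv u) = u := by
  simp [wordInv, List.map_reverse, Function.comp_def, Letter.inv]

namespace IsComponents

variable {A : Type*} {S P M P' M' : Set (List (Letter A))}

theorem symm (h : IsComponents S P M) (hinv : ∀ x ∈ S, wordInv x ∈ S) :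
    IsComponents S M P where
  factorial_left := h.factorial_right
  factorial_right := h.factorial_left
  eq_union := h.eq_union.trans (union_comm P M)
  inter := (inter_comm M P).trans h.inter
  mem_right_iff x hx := by
    rw [h.mem_right_iff _ (hinv x hx), wordInv_wordInv]

theorem nil_mem_left (h : IsComponents S P M) : [] ∈ P :=
  (h.inter.ge rfl).1

theorem nil_mem_right (h : IsComponents S P M) : [] ∈ M :=
  (h.inter.ge rfl).2

theorem eq_nil (h : IsComponents S P M) {u : List (Letter A)} (hP : u ∈ P) (hM : u ∈ M) :
    u = [] :=
  h.inter.le ⟨hP, hM⟩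

/-- If a word of `S` has a nonempty prefix in `P`, then all its suffixes are in `P`. -/
theorem mem_left_of_append (h : IsComponents S P M) {u v w : List (Letter A)} (hu : u ∈ P)
    (hne : u ≠ []) (hS : u ++ v ++ w ∈ S) : w ∈ P := by
  rw [h.eq_union] at hS
  rcases hS with hS | hS
  · exact h.factorial_left _ hS _ (List.suffix_append _ _).isInfix
  · exact absurd (h.eq_nil hu (h.factorial_right _ hS _ ⟨[], v ++ w, by simp⟩)) hne

theorem subset_of_common (h : IsComponents S P M) (h' : IsComponents S P' M')
    (hsr : SemiRecurrent S) {u : List (Letter A)} (hu : u ∈ P) (hu' : u ∈ P') (hne : u ≠ []) :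
    P ⊆ P' ∧ M ⊆ M' := by
  have huS : u ∈ S := h.eq_union ▸ Or.inl hu
  constructor <;> intro w hw <;> by_cases hw0 : w = []
  · exact hw0 ▸ h'.nil_mem_left
  · have hwS : w ∈ S := h.eq_union ▸ Or.inl hw
    obtain ⟨v, -, hv | hv⟩ := hsr u huS w hwS
    · exact h'.mem_left_of_append hu' hne hv
    · exact absurd (h.eq_nil hw ((h.mem_right_iff w hwS).2 (h.mem_left_of_append hu hne hv))) hw0
  · exact hw0 ▸ h'.nil_mem_right
  · have hwS : w ∈ S := h.eq_union ▸ Or.inr hw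
    obtain ⟨v, -, hv | hv⟩ := hsr u huS w hwS
    · exact absurd (h.eq_nil (h.mem_left_of_append hu hne hv) hw) hw0
    · exact (h'.mem_right_iff w hwS).2 (h'.mem_left_of_append hu' hne hv)

theorem eq_of_common (h : IsComponents S P M) (h' : IsComponents S P' M')
    (hsr : SemiRecurrent S) {u : List (Letter A)} (hu : u ∈ P) (hu' : u ∈ P') (hne : u ≠ []) :
    P = P' ∧ M = M' :=
  have hle := h.subset_of_common h' hsr hu hu' hne
  have hge := h'.subset_of_common h hsr hu' hu hne
  ⟨hle.1.antisymm hge.1, hle.2.antisymm hge.2⟩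

end IsComponents

/-- the pair of components of a semi-recurrent orientable
laminary set is unique up to interchange. -/
theorem stmt_19 {A : Type*} [Fintype A] [Nonempty A]
    (S Sp Sm Sp' Sm' : Set (List (Letter A)))
    (hlam : Laminary S) (hsr : SemiRecurrent S)
    (hfp : FactorialSet Sp) (hfm : FactorialSet Sm)
    (hun : S = Sp ∪ Sm) (hint : Sp ∩ Sm = {([] : List (Letter A))})
    (hinv : ∀ x ∈ S, (x ∈ Sm ↔ wordInv x ∈ Sp))
    (hfp' : FactorialSet Sp') (hfm' : FactorialSet Sm')
    (hun' : S = Sp' ∪ Sm') (hint' : Sp' ∩ Sm' = {([] : List (Letter A))})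
    (hinv' : ∀ x ∈ S, (x ∈ Sm' ↔ wordInv x ∈ Sp')) :
    (Sp = Sp' ∧ Sm = Sm') ∨ (Sp = Sm' ∧ Sm = Sp') := by
  have h : IsComponents S Sp Sm := ⟨hfp, hfm, hun, hint, hinv⟩
  have h' : IsComponents S Sp' Sm' := ⟨hfp', hfm', hun', hint', hinv'⟩
  by_cases hS : ∃ u ∈ S, u ≠ []
  · obtain ⟨u, hu, hne⟩ := hS
    have hs := h.symm hlam.2.1
    have hs' := h'.symm hlam.2.1
    rcases hun.le hu with hp | hm <;> rcases hun'.le hu with hp' | hm'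
    · exact Or.inl (h.eq_of_common h' hsr hp hp' hne)
    · exact Or.inr (h.eq_of_common hs' hsr hp hm' hne)
    · exact Or.inr (hs.eq_of_common h' hsr hm hp' hne).symm
    · exact Or.inl (hs.eq_of_common hs' hsr hm hm' hne).symm
  · push Not at hS
    have key : ∀ P ⊆ S, [] ∈ P → P = {[]} := fun P hP h0 =>
      Subset.antisymm (fun x hx => hS x (hP hx)) (singleton_subset_iff.2 h0)
    refine Or.inl ⟨?_, ?_⟩
    · rw [key Sp (hun ▸ subset_union_left) h.nil_mem_left,
        key Sp' (hun' ▸ subset_union_left) h'.nil_mem_left]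
    · rw [key Sm (hun ▸ subset_union_right) h.nil_mem_right,
        key Sm' (hun' ▸ subset_union_right) h'.nil_mem_right]

end LinInv
end
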